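/- Let (X,d,m) be an isotropic PI space. Fix two indecomposable sets E, F ⊆ X of finite perimeter. Suppose that either m(E ∩ F) > 0 or H(∂^e E ∩ ∂^e F) > 0. Then E ∪ F is an indecomposable set. -/

import Mathlib

open MeasureTheory Metric Filter Set
open scoped ENNReal NNReal Topology

namespace PaperBV

noncomputable section

variable {X : Type*} [MetricSpace X]

/-- `f` is locally Lipschitz on `Ω`. -/
def LocLipOn (Ω : Set X) (f : X → ℝ) : Prop :=
  ∀ x ∈ Ω, ∃ K : ℝ≥0, ∃ t ∈ 𝓝[Ω] x, LipschitzOnWith K f t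

/-- The local Lipschitz constant (slope) `lip f` of a function, with value `0` at
points that are not accumulation points (there the filter `𝓝[≠] x` is trivial). -/
def lipConst (f : X → ℝ) (x : X) : ℝ≥0∞ :=
  Filter.limsup (fun y => ENNReal.ofReal (|f y - f x| / dist y x)) (𝓝[≠] x)

variable [MeasurableSpace X]

/-- Convergence `fn → f` in `L¹_loc(μ⌊Ω)`. -/
def TendstoL1loc (μ : Measure X) (Ω : Set X) (fn : ℕ → X → ℝ) (f : X → ℝ) : Prop :=
  ∀ K : Set X, IsCompact K → K ⊆ Ω →
    Filter.Tendsto (fun n => ∫⁻ x in K, ENNReal.ofReal |fn n x - f x| ∂μ)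
      Filter.atTop (𝓝 0)

/-- The total variation `|Df|(Ω)` of `f` on an open set `Ω`, defined by relaxation of the
integral of the local Lipschitz constant along locally Lipschitz approximations. -/
def tvOpen (μ : Measure X) (f : X → ℝ) (Ω : Set X) : ℝ≥0∞ :=
  sInf { a : ℝ≥0∞ | ∃ fn : ℕ → X → ℝ, (∀ n, LocLipOn Ω (fn n)) ∧ TendstoL1loc μ Ω fn f ∧
    a = Filter.liminf (fun n => ∫⁻ x in Ω, lipConst (fn n) x ∂μ) Filter.atTop }

/-- The total variation measure `|Df|(B)` of `f` on an arbitrary set, obtained from the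
values on open sets by the Carathéodory construction. -/
def tv (μ : Measure X) (f : X → ℝ) (B : Set X) : ℝ≥0∞ :=
  ⨅ (Ω : Set X) (_ : IsOpen Ω) (_ : B ⊆ Ω), tvOpen μ f Ω

/-- `f` is a function of bounded variation: `f ∈ L¹(μ)` and `|Df|(X) < ∞`. -/
def BVFun (μ : Measure X) (f : X → ℝ) : Prop :=
  MeasureTheory.Integrable f μ ∧ tv μ f Set.univ < ⊤

/-- The perimeter `P(E, B) = |D 1_E|(B)`. -/
def perim (μ : Measure X) (E B : Set X) : ℝ≥0∞ :=
  tv μ (E.indicator fun _ => (1 : ℝ)) B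

/-- `E` is a (Borel) set of finite perimeter. -/
def FinPerim (μ : Measure X) (E : Set X) : Prop :=
  MeasurableSet E ∧ perim μ E Set.univ < ⊤

/-- `μ` is a doubling measure with doubling constant `CD`. -/
def Doubling (μ : Measure X) (CD : ℝ≥0) : Prop :=
  1 ≤ CD ∧ ∀ (x : X) (r : ℝ), 0 < r → μ (ball x (2 * r)) ≤ (CD : ℝ≥0∞) * μ (ball x r)

/-- The mean value `f_{x,r}` of `f` on the ball `B_r(x)`. -/
def ballAvg (μ : Measure X) (f : X → ℝ) (x : X) (r : ℝ) : ℝ :=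
  (∫ y in ball x r, f y ∂μ) / (μ (ball x r)).toReal

/-- The weak `(1,1)`-Poincaré inequality with constants `CP`, `lam`,
for locally Lipschitz functions. -/
def WeakPoincare (μ : Measure X) (CP lam : ℝ) : Prop :=
  ∀ f : X → ℝ, LocLipOn Set.univ f → ∀ (x : X) (r : ℝ), 0 < r →
    ∫⁻ y in ball x r, ENNReal.ofReal |f y - ballAvg μ f x r| ∂μ ≤
      ENNReal.ofReal (CP * r) * ∫⁻ y in ball x (lam * r), lipConst f y ∂μ

/-- A PI space: doubling and supporting a weak `(1,1)`-Poincaré inequality. -/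
def IsPI (μ : Measure X) : Prop :=
  ∃ (CD : ℝ≥0) (CP lam : ℝ), Doubling μ CD ∧ 0 < CP ∧ 1 ≤ lam ∧ WeakPoincare μ CP lam

/-- The pre-measure `H_δ` of the codimension-one Hausdorff measure: infimum over countable
covers by balls of radii at most `δ` of `∑ μ(B_{r_i}(x_i)) / (2 r_i)`. -/
def preH (μ : Measure X) (δ : ℝ) (S : Set X) : ℝ≥0∞ :=
  ⨅ (c : ℕ → X × ℝ) (_ : ∀ i, 0 < (c i).2 ∧ (c i).2 ≤ δ)
    (_ : S ⊆ ⋃ i, ball (c i).1 (c i).2),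
    ∑' i, μ (ball (c i).1 (c i).2) / ENNReal.ofReal (2 * (c i).2)

/-- The codimension-one Hausdorff measure `H = lim_{δ ↓ 0} H_δ = sup_{δ > 0} H_δ`
(as an outer-measure-type set function). -/
def codimH (μ : Measure X) (S : Set X) : ℝ≥0∞ :=
  ⨆ (δ : ℝ) (_ : 0 < δ), preH μ δ S

/-- The upper density of `E` at `x`. -/
def upperDens (μ : Measure X) (E : Set X) (x : X) : ℝ≥0∞ :=
  Filter.limsup (fun r : ℝ => μ (E ∩ ball x r) / μ (ball x r)) (𝓝[>] (0 : ℝ))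

/-- The essential boundary `∂^e E`. -/
def essBdry (μ : Measure X) (E : Set X) : Set X :=
  {x | 0 < upperDens μ E x ∧ 0 < upperDens μ Eᶜ x}

/-- The essential interior `E^1`: points of density `1`. -/
def essInt (μ : Measure X) (E : Set X) : Set X :=
  {x | Filter.Tendsto (fun r : ℝ => μ (E ∩ ball x r) / μ (ball x r))
    (𝓝[>] (0 : ℝ)) (𝓝 (1 : ℝ≥0∞))}

/-- Integral `∫_S f dν` with respect to an outer-measure-type set function `ν`,
via the layer-cake formula. -/
def outerLint (ν : Set X → ℝ≥0∞) (S : Set X) (f : X → ℝ≥0∞) : ℝ≥0∞ :=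
  ∫⁻ t in Set.Ioi (0 : ℝ), ν {x ∈ S | ENNReal.ofReal t < f x}

/-- `θ` is a family of densities representing the perimeter measures with respect to the
codimension-one Hausdorff measure: `P(E,B) = ∫_{B ∩ ∂^e E} θ_E dH`, with
`γ ≤ θ_E ≤ C` on `∂^e E` for structural constants `0 < γ`, `C < ∞`. -/
def PerimRepr (μ : Measure X) (θ : Set X → X → ℝ≥0∞) : Prop :=
  ∃ γ C : ℝ≥0∞, 0 < γ ∧ C ≠ ⊤ ∧
    ∀ E : Set X, FinPerim μ E →
      (∀ x ∈ essBdry μ E, γ ≤ θ E x ∧ θ E x ≤ C) ∧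
      ∀ B : Set X, MeasurableSet B →
        perim μ E B = outerLint (codimH μ) (B ∩ essBdry μ E) (θ E)

/-- The space is isotropic: the densities `θ_E` can be chosen so that, whenever `F ⊆ E` are
sets of finite perimeter, `θ_F = θ_E` holds `H`-a.e. on `∂^e F ∩ ∂^e E`. -/
def Isotropic (μ : Measure X) : Prop :=
  ∃ θ : Set X → X → ℝ≥0∞, PerimRepr μ θ ∧
    ∀ E F : Set X, FinPerim μ E → FinPerim μ F → F ⊆ E →
      codimH μ {x ∈ essBdry μ F ∩ essBdry μ E | θ F x ≠ θ E x} = 0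

/-- Property (1.2): `H(∂^e E ∩ ∂^e F ∩ ∂^e (E ∪ F)) = 0` for disjoint sets of finite
perimeter. -/
def Prop12 (μ : Measure X) : Prop :=
  ∀ E F : Set X, FinPerim μ E → FinPerim μ F → Disjoint E F →
    codimH μ (essBdry μ E ∩ essBdry μ F ∩ essBdry μ (E ∪ F)) = 0

/-- `E` is decomposable in `B`: `E ∩ B` admits a partition into two sets of finite perimeter
and positive measure such that the perimeter in `B` is additive. -/
def DecomposableIn (μ : Measure X) (E B : Set X) : Prop :=
  ∃ F G : Set X, FinPerim μ F ∧ FinPerim μ G ∧ Disjoint F G ∧ F ∪ G = E ∩ B ∧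
    0 < μ F ∧ 0 < μ G ∧ perim μ E B = perim μ F B + perim μ G B

/-- `E` is a set of finite perimeter which is indecomposable in `B`. -/
def IndecomposableIn (μ : Measure X) (E B : Set X) : Prop :=
  FinPerim μ E ∧ ¬ DecomposableIn μ E B

/-- `E` is an indecomposable set (of finite perimeter). -/
def Indecomposable (μ : Measure X) (E : Set X) : Prop :=
  IndecomposableIn μ E Set.univ

/-- `E` is a simple set. -/
def SimpleSet (μ : Measure X) (E : Set X) : Prop :=
  FinPerim μ E ∧ μ E < ⊤ ∧
  ∀ F : Set X, FinPerim μ F → codimH μ (essBdry μ F \ essBdry μ E) = 0 →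
    μ F = 0 ∨ μ Fᶜ = 0 ∨ μ (symmDiff F E) = 0 ∨ μ (symmDiff F Eᶜ) = 0

end

section CodimensionOneMeasure

variable {X : Type*} [MetricSpace X] [MeasurableSpace X] {μ : Measure X}

theorem preH_le_tsum {δ : ℝ} {S : Set X} (c : ℕ → X × ℝ)
    (hc : ∀ i, 0 < (c i).2 ∧ (c i).2 ≤ δ) (hS : S ⊆ ⋃ i, ball (c i).1 (c i).2) :
    preH μ δ S ≤ ∑' i, μ (ball (c i).1 (c i).2) / ENNReal.ofReal (2 * (c i).2) :=
  iInf_le_of_le c (iInf_le_of_le hc (iInf_le_of_le hS le_rfl))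

theorem exists_cover_of_preH_lt {δ : ℝ} {S : Set X} {a : ℝ≥0∞} (h : preH μ δ S < a) :
    ∃ c : ℕ → X × ℝ, (∀ i, 0 < (c i).2 ∧ (c i).2 ≤ δ) ∧ (S ⊆ ⋃ i, ball (c i).1 (c i).2) ∧
      ∑' i, μ (ball (c i).1 (c i).2) / ENNReal.ofReal (2 * (c i).2) < a := by
  simp only [preH, iInf_lt_iff] at h
  obtain ⟨c, hc, hS, h⟩ := h
  exact ⟨c, hc, hS, h⟩

theorem preH_mono (δ : ℝ) {S T : Set X} (h : S ⊆ T) : preH μ δ S ≤ preH μ δ T :=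
  le_iInf fun c => le_iInf fun hc => le_iInf fun hT => preH_le_tsum c hc (h.trans hT)

theorem preH_anti {δ δ' : ℝ} (h : δ ≤ δ') (S : Set X) : preH μ δ' S ≤ preH μ δ S :=
  le_iInf fun c => le_iInf fun hc => le_iInf fun hS =>
    preH_le_tsum c (fun i => ⟨(hc i).1, (hc i).2.trans h⟩) hS

theorem preH_le_codimH {δ : ℝ} (hδ : 0 < δ) (S : Set X) : preH μ δ S ≤ codimH μ S :=
  le_iSup₂_of_le δ hδ le_rfl

theorem preH_iUnion_le (δ : ℝ) (S : ℕ → Set X) :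
    preH μ δ (⋃ n, S n) ≤ ∑' n, preH μ δ (S n) := by
  refine ENNReal.le_of_forall_pos_le_add fun ε hε hfin => ?_
  obtain ⟨ε', hε', hsum⟩ :=
    ENNReal.exists_pos_sum_of_countable (ENNReal.coe_pos.2 hε).ne' ℕ
  have hlt : ∀ n, preH μ δ (S n) < preH μ δ (S n) + ε' n := fun n =>
    ENNReal.lt_add_right (ENNReal.ne_top_of_tsum_ne_top hfin.ne n)
      (ENNReal.coe_pos.2 (hε' n)).ne'
  choose c hc hcov hcsum using fun n => exists_cover_of_preH_lt (hlt n)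
  have key := preH_le_tsum (μ := μ) (δ := δ) (S := ⋃ n, S n)
    (fun k => c (Nat.pairEquiv.symm k).1 (Nat.pairEquiv.symm k).2)
    (fun k => hc _ _) (by
      refine iUnion_subset fun n x hx => ?_
      obtain ⟨i, hi⟩ := mem_iUnion.1 (hcov n hx)
      exact mem_iUnion.2 ⟨Nat.pairEquiv (n, i), by simpa using hi⟩)
  refine key.trans ?_
  rw [Nat.pairEquiv.symm.tsum_eq (fun p : ℕ × ℕ =>
    μ (ball (c p.1 p.2).1 (c p.1 p.2).2) / ENNReal.ofReal (2 * (c p.1 p.2).2)),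
    ENNReal.tsum_prod (f := fun n i =>
      μ (ball (c n i).1 (c n i).2) / ENNReal.ofReal (2 * (c n i).2))]
  calc _ ≤ ∑' n, (preH μ δ (S n) + ε' n) := ENNReal.tsum_le_tsum fun n => (hcsum n).le
    _ = ∑' n, preH μ δ (S n) + ∑' n, (ε' n : ℝ≥0∞) := ENNReal.tsum_add
    _ ≤ _ := by gcongr

/-- The codimension-one Hausdorff measure as an outer measure. Covers are infinite sequences of
genuine balls, so the empty set being null is a condition on `μ`. -/
noncomputable def codimOuterMeasure (μ : Measure X) (h₀ : codimH μ ∅ = 0) : OuterMeasure X where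
  measureOf := codimH μ
  empty := h₀
  mono h := iSup₂_mono fun δ _ => preH_mono δ h
  iUnion_nat S _ := iSup₂_le fun δ hδ =>
    (preH_iUnion_le δ S).trans (ENNReal.tsum_le_tsum fun n => preH_le_codimH hδ (S n))

theorem codimOuterMeasure_apply (h₀ : codimH μ ∅ = 0) (S : Set X) :
    codimOuterMeasure μ h₀ S = codimH μ S := rfl

/-- Additivity of the pre-measure on sets at distance larger than `2 * δ`: the balls of a cover
missing one of the sets are replaced by balls of small total weight. -/
theorem preH_add_le_preH_union (h₀ : codimH μ ∅ = 0) {δ : ℝ} (hδ : 0 < δ) {S T : Set X}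
    (hST : ∀ x ∈ S, ∀ y ∈ T, 2 * δ ≤ dist x y) :
    preH μ δ S + preH μ δ T ≤ preH μ δ (S ∪ T) := by
  classical
  refine ENNReal.le_of_forall_pos_le_add fun ε hε hfin => ?_
  have hε3 : (0 : ℝ≥0∞) < (ε / 3 : ℝ≥0) := ENNReal.coe_pos.2 (by positivity)
  obtain ⟨e, he, -, hesum⟩ := exists_cover_of_preH_lt
    (((preH_le_codimH hδ ∅).trans h₀.le).trans_lt hε3)
  obtain ⟨c, hc, hcov, hcsum⟩ := exists_cover_of_preH_lt
    (ENNReal.lt_add_right hfin.ne hε3.ne')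
  set w : X × ℝ → ℝ≥0∞ := fun p => μ (ball p.1 p.2) / ENNReal.ofReal (2 * p.2)
  set A : Set ℕ := {i | (ball (c i).1 (c i).2 ∩ S).Nonempty}
  set B : Set ℕ := {i | (ball (c i).1 (c i).2 ∩ T).Nonempty}
  have hAB : ∀ i, i ∈ A → i ∈ B → False := by
    rintro i ⟨x, hx, hxS⟩ ⟨y, hy, hyT⟩
    have h1 := hST x hxS y hyT
    have h2 := dist_triangle_right x y (c i).1
    have h3 := (hc i).2
    rw [mem_ball] at hx hy
    linarith
  have hbound : ∀ (D : Set ℕ) (U : Set X), U ⊆ S ∪ T →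
      (∀ i, (ball (c i).1 (c i).2 ∩ U).Nonempty → i ∈ D) →
      preH μ δ U ≤ ∑' i, (if i ∈ D then w (c i) else 0) + ∑' i, w (e i) := by
    intro D U hU hD
    have := preH_le_tsum (μ := μ) (δ := δ) (S := U) (fun i => if i ∈ D then c i else e i)
      (fun i => by by_cases hi : i ∈ D <;> simp only [hi, if_true, if_false, hc i, he i, and_self])
      (fun x hx => by
        obtain ⟨i, hi⟩ := mem_iUnion.1 (hcov (hU hx))
        refine mem_iUnion.2 ⟨i, ?_⟩
        rwa [if_pos (hD i ⟨x, hi, hx⟩)])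
    refine this.trans ?_
    rw [← ENNReal.tsum_add]
    refine ENNReal.tsum_le_tsum fun i => ?_
    by_cases hi : i ∈ D <;> simp [hi, w]
  have hsplit : ∑' i, (if i ∈ A then w (c i) else 0) + ∑' i, (if i ∈ B then w (c i) else 0) ≤
      ∑' i, w (c i) := by
    rw [← ENNReal.tsum_add]
    refine ENNReal.tsum_le_tsum fun i => ?_
    by_cases hA : i ∈ A
    · have hB : i ∉ B := hAB i hA
      simp [hA, hB]
    · by_cases hB : i ∈ B <;> simp [hA, hB]
  have hεε : ((ε / 3 : ℝ≥0) : ℝ≥0∞) + (ε / 3 : ℝ≥0) + (ε / 3 : ℝ≥0) = ε := by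
    rw [← ENNReal.coe_add, ← ENNReal.coe_add, add_thirds]
  calc preH μ δ S + preH μ δ T
      ≤ (∑' i, (if i ∈ A then w (c i) else 0) + ∑' i, w (e i)) +
        (∑' i, (if i ∈ B then w (c i) else 0) + ∑' i, w (e i)) :=
        add_le_add (hbound A S subset_union_left fun i hi => hi)
          (hbound B T subset_union_right fun i hi => hi)
    _ = (∑' i, (if i ∈ A then w (c i) else 0) + ∑' i, (if i ∈ B then w (c i) else 0)) +
        (∑' i, w (e i) + ∑' i, w (e i)) := add_add_add_comm _ _ _ _
    _ ≤ (preH μ δ (S ∪ T) + (ε / 3 : ℝ≥0)) + ((ε / 3 : ℝ≥0) + (ε / 3 : ℝ≥0)) :=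
        add_le_add (hsplit.trans hcsum.le) (add_le_add hesum.le hesum.le)
    _ = preH μ δ (S ∪ T) + ε := by rw [← hεε]; ring

theorem codimOuterMeasure_isMetric (h₀ : codimH μ ∅ = 0) :
    (codimOuterMeasure μ h₀).IsMetric := by
  rintro S T ⟨r, hr0, hr⟩
  refine le_antisymm (measure_union_le S T) ?_
  simp only [codimOuterMeasure_apply]
  obtain ⟨ρ, hρ0, hρr⟩ := ENNReal.lt_iff_exists_nnreal_btwn.1 (pos_iff_ne_zero.2 hr0)
  have hρ : (0 : ℝ) < ρ := by exact_mod_cast hρ0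
  have hdist : ∀ x ∈ S, ∀ y ∈ T, (ρ : ℝ) ≤ dist x y := fun x hx y hy => by
    have h := hρr.le.trans (hr x hx y hy)
    rw [edist_nndist, ENNReal.coe_le_coe] at h
    exact_mod_cast h
  unfold codimH
  refine ENNReal.biSup_add_biSup_le' ⟨1, one_pos⟩ ⟨1, one_pos⟩ fun δ hδ δ' hδ' => ?_
  have hη : 0 < min (min δ δ') (ρ / 2) := by positivity
  refine le_trans ?_ (preH_le_codimH hη (S ∪ T))
  refine le_trans (add_le_add (preH_anti ?_ S) (preH_anti ?_ T))
    (preH_add_le_preH_union h₀ hη fun x hx y hy => ?_)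
  · exact (min_le_left _ _).trans (min_le_left _ _)
  · exact (min_le_left _ _).trans (min_le_right _ _)
  · linarith [hdist x hx y hy, min_le_right (min δ δ') ((ρ : ℝ) / 2)]

theorem codimOuterMeasure_isCaratheodory [BorelSpace X] (h₀ : codimH μ ∅ = 0) {S : Set X}
    (hS : MeasurableSet S) : (codimOuterMeasure μ h₀).IsCaratheodory S :=
  (codimOuterMeasure_isMetric h₀).le_caratheodory S hS

end CodimensionOneMeasure

section LayerCake

variable {X : Type*} (ν : OuterMeasure X) {S : Set X} {f g : X → ℝ≥0∞}

theorem measurable_measure_superlevel (S : Set X) (f : X → ℝ≥0∞) :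
    Measurable fun t : ℝ => ν {x ∈ S | ENNReal.ofReal t < f x} :=
  Antitone.measurable fun _ _ hst => measure_mono fun _ hx =>
    ⟨hx.1, (ENNReal.ofReal_le_ofReal hst).trans_lt hx.2⟩

theorem outerLint_inter_add_diff {A : Set X} (hA : ν.IsCaratheodory A) (S : Set X)
    (f : X → ℝ≥0∞) : outerLint ν (S ∩ A) f + outerLint ν (S \ A) f = outerLint ν S f := by
  unfold outerLint
  rw [← lintegral_add_left (measurable_measure_superlevel ν _ _)]
  refine lintegral_congr fun t => ?_
  rw [hA {x ∈ S | ENNReal.ofReal t < f x}]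
  congr 2 <;> ext x <;> simp only [mem_inter_iff, Set.mem_sdiff, mem_ofPred_eq] <;> tauto

theorem outerLint_le_of_null (h : ν {x ∈ S | f x ≠ g x} = 0) :
    outerLint ν S f ≤ outerLint ν S g := by
  refine lintegral_mono fun t => ?_
  calc ν {x ∈ S | ENNReal.ofReal t < f x}
      ≤ ν ({x ∈ S | ENNReal.ofReal t < g x} ∪ {x ∈ S | f x ≠ g x}) := by
        refine measure_mono fun x hx => ?_
        by_cases hfg : f x = g x
        · exact Or.inl ⟨hx.1, hfg ▸ hx.2⟩
        · exact Or.inr ⟨hx.1, hfg⟩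
    _ ≤ ν {x ∈ S | ENNReal.ofReal t < g x} + ν {x ∈ S | f x ≠ g x} := measure_union_le _ _
    _ = ν {x ∈ S | ENNReal.ofReal t < g x} := by rw [h, add_zero]

theorem outerLint_congr_of_null (h : ν {x ∈ S | f x ≠ g x} = 0) :
    outerLint ν S f = outerLint ν S g :=
  le_antisymm (outerLint_le_of_null ν h) (outerLint_le_of_null ν (by simpa only [ne_comm] using h))

theorem outerLint_of_null (h : ν S = 0) : outerLint ν S f = 0 := by
  have : ∀ t : ℝ, ν {x ∈ S | ENNReal.ofReal t < f x} = 0 := fun t =>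
    measure_mono_null (sep_subset _ _) h
  simp [outerLint, this]

theorem null_of_outerLint_eq_zero {γ : ℝ≥0∞} (hγ : 0 < γ) (hf : ∀ x ∈ S, γ ≤ f x)
    (h : outerLint ν S f = 0) : ν S = 0 := by
  obtain ⟨ρ, hρ0, hργ⟩ := ENNReal.lt_iff_exists_nnreal_btwn.1 hγ
  have hρ : (0 : ℝ) < ρ := by exact_mod_cast hρ0
  have hle : ∫⁻ _ in Ioo (0 : ℝ) ρ, ν S ≤ outerLint ν S f := by
    refine le_trans ?_ (lintegral_mono_set (s := Ioo 0 (ρ : ℝ)) (t := Ioi 0) Ioo_subset_Ioi_self)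
    refine setLIntegral_mono' measurableSet_Ioo fun t ht => measure_mono fun x hx => ⟨hx, ?_⟩
    refine lt_of_le_of_lt ?_ (hργ.trans_le (hf x hx))
    rw [← ENNReal.ofReal_coe_nnreal]
    exact ENNReal.ofReal_le_ofReal ht.2.le
  rw [h, setLIntegral_const, Real.volume_Ioo, sub_zero] at hle
  simpa [hρ.not_ge, (show ρ ≠ 0 from by exact_mod_cast hρ.ne')] using hle

end LayerCake

section UpperDensity

variable {X : Type*} [MetricSpace X] [MeasurableSpace X] {μ : Measure X}

theorem limsup_add_le_add {ι : Type*} (l : Filter ι) (u v : ι → ℝ≥0∞) :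
    limsup (fun i => u i + v i) l ≤ limsup u l + limsup v l := by
  refine ENNReal.le_of_forall_pos_le_add fun ε hε hfin => ?_
  rw [ENNReal.add_lt_top] at hfin
  have hε2 : ((ε / 2 : ℝ≥0) : ℝ≥0∞) ≠ 0 := (ENNReal.coe_pos.2 (half_pos hε)).ne'
  refine limsup_le_of_le (by isBoundedDefault) ?_
  filter_upwards [eventually_lt_of_limsup_lt (ENNReal.lt_add_right hfin.1.ne hε2),
    eventually_lt_of_limsup_lt (ENNReal.lt_add_right hfin.2.ne hε2)] with i hu hv
  calc u i + v i ≤ _ := add_le_add hu.le hv.le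
    _ = limsup u l + limsup v l + ((ε / 2 : ℝ≥0) + (ε / 2 : ℝ≥0)) := add_add_add_comm _ _ _ _
    _ = limsup u l + limsup v l + ε := by rw [← ENNReal.coe_add, add_halves]

theorem upperDens_mono_ae {E F : Set X} (h : E ≤ᵐ[μ] F) (x : X) :
    upperDens μ E x ≤ upperDens μ F x :=
  limsup_le_limsup (Eventually.of_forall fun r => ENNReal.div_le_div_right
    (measure_mono_ae (h.inter (EventuallyLE.refl _ (ball x r)))) _)

theorem upperDens_mono {E F : Set X} (h : E ⊆ F) (x : X) :
    upperDens μ E x ≤ upperDens μ F x :=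
  upperDens_mono_ae h.eventuallyLE x

theorem upperDens_union_le (E F : Set X) (x : X) :
    upperDens μ (E ∪ F) x ≤ upperDens μ E x + upperDens μ F x := by
  refine le_trans (limsup_le_limsup (Eventually.of_forall fun r => ?_))
    (limsup_add_le_add (𝓝[>] (0 : ℝ)) _ _)
  simp only
  rw [← ENNReal.add_div, union_inter_distrib_right]
  exact ENNReal.div_le_div_right (measure_union_le _ _) _

theorem upperDens_pos_or_of_union {E F : Set X} {x : X} (h : 0 < upperDens μ (E ∪ F) x) :
    0 < upperDens μ E x ∨ 0 < upperDens μ F x :=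
  add_pos_iff.1 (h.trans_le (upperDens_union_le E F x))

theorem mem_essBdry_inter_of_disjoint {E F : Set X} (hEF : Disjoint E F) {x : X}
    (hE : 0 < upperDens μ E x) (hF : 0 < upperDens μ F x) : x ∈ essBdry μ E ∩ essBdry μ F :=
  ⟨⟨hE, hF.trans_le (upperDens_mono hEF.subset_compl_left x)⟩,
    ⟨hF, hE.trans_le (upperDens_mono hEF.subset_compl_right x)⟩⟩

theorem essBdry_union_subset (E F : Set X) :
    essBdry μ (E ∪ F) ⊆ essBdry μ E ∪ essBdry μ F := by
  rintro x ⟨h, hc⟩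
  refine (upperDens_pos_or_of_union h).imp (fun hE => ⟨hE, ?_⟩) (fun hF => ⟨hF, ?_⟩)
  · exact hc.trans_le (upperDens_mono (compl_subset_compl.2 subset_union_left) x)
  · exact hc.trans_le (upperDens_mono (compl_subset_compl.2 subset_union_right) x)

theorem essBdry_diff_essBdry_union_subset {E F : Set X} (hEF : Disjoint E F) :
    essBdry μ E \ essBdry μ (E ∪ F) ⊆ essBdry μ E ∩ essBdry μ F := by
  rintro x ⟨⟨hE, hEc⟩, hx⟩
  refine mem_essBdry_inter_of_disjoint hEF hE ?_
  have hsub : Eᶜ ⊆ (E ∪ F)ᶜ ∪ F := by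
    intro y hy
    by_cases hyF : y ∈ F
    · exact Or.inr hyF
    · exact Or.inl fun h => h.elim hy hyF
  refine (upperDens_pos_or_of_union (hEc.trans_le (upperDens_mono hsub x))).resolve_left
    fun h => hx ⟨hE.trans_le (upperDens_mono subset_union_left x), h⟩

theorem measure_inter_ball_eq_iSup_rat (μ : Measure X) (E : Set X) (x : X) (r : ℝ) :
    μ (E ∩ ball x r) = ⨆ q : {q : ℚ // (q : ℝ) < r}, μ (E ∩ ball x (q : ℚ)) := by
  have hball : E ∩ ball x r = ⋃ q : {q : ℚ // (q : ℝ) < r}, E ∩ ball x (q : ℚ) := by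
    ext y
    simp only [mem_inter_iff, mem_iUnion, mem_ball]
    constructor
    · rintro ⟨hyE, hy⟩
      obtain ⟨q, hyq, hqr⟩ := exists_rat_btwn hy
      exact ⟨⟨q, hqr⟩, hyE, hyq⟩
    · rintro ⟨q, hyE, hy⟩
      exact ⟨hyE, hy.trans q.2⟩
  rw [hball]
  refine Directed.measure_iUnion (Monotone.directed_le fun p q hpq => ?_)
  exact inter_subset_inter_right _ (ball_subset_ball (by exact_mod_cast hpq))

theorem lowerSemicontinuous_measure_inter_ball (μ : Measure X) (E : Set X) (r : ℝ) :
    LowerSemicontinuous fun x => μ (E ∩ ball x r) := by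
  intro x a ha
  simp only [gt_iff_lt] at ha
  rw [measure_inter_ball_eq_iSup_rat, lt_iSup_iff] at ha
  obtain ⟨q, hq⟩ := ha
  filter_upwards [ball_mem_nhds x (sub_pos.2 q.2)] with y hy
  refine hq.trans_le (measure_mono (inter_subset_inter_right _ (ball_subset_ball' ?_)))
  rw [mem_ball'] at hy
  linarith

theorem upperDens_eq_iInf_iSup (E : Set X) (x : X) :
    upperDens μ E x = ⨅ n : ℕ, ⨆ q : {q : ℚ // (q : ℝ) ∈ Ioo (0 : ℝ) (1 / (n + 1))},
      μ (E ∩ ball x (q : ℚ)) / μ (ball x (q : ℚ)) := by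
  rw [upperDens, (nhdsGT_basis (0 : ℝ)).limsup_eq_iInf_iSup]
  apply le_antisymm
  · refine le_iInf fun n => iInf₂_le_of_le (1 / ((n : ℝ) + 1)) (by positivity) ?_
    refine iSup₂_le fun r hr => ?_
    rw [measure_inter_ball_eq_iSup_rat, ENNReal.iSup_div]
    refine iSup_le fun q => ?_
    rcases le_or_gt (q : ℝ) 0 with hq | hq
    · simp [ball_eq_empty.2 hq]
    · refine le_iSup_of_le ⟨q, hq, q.2.trans hr.2⟩ ?_
      exact ENNReal.div_le_div_left (measure_mono (ball_subset_ball q.2.le)) _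
  · refine le_iInf₂ fun δ hδ => ?_
    obtain ⟨n, hn⟩ := exists_nat_one_div_lt hδ
    refine iInf_le_of_le n (iSup_le fun q => ?_)
    exact le_iSup₂_of_le (q : ℝ) ⟨q.2.1, q.2.2.trans hn⟩ le_rfl

theorem measurable_upperDens [BorelSpace X] (μ : Measure X) (E : Set X) :
    Measurable (upperDens μ E) := by
  have h : upperDens μ E = fun x => ⨅ n : ℕ,
      ⨆ q : {q : ℚ // (q : ℝ) ∈ Ioo (0 : ℝ) (1 / (n + 1))},
        μ (E ∩ ball x (q : ℚ)) / μ (ball x (q : ℚ)) :=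
    funext (upperDens_eq_iInf_iSup E)
  rw [h]
  refine Measurable.iInf fun n => Measurable.iSup fun q => ?_
  refine (lowerSemicontinuous_measure_inter_ball μ E _).measurable.div ?_
  simpa using (lowerSemicontinuous_measure_inter_ball μ univ (q : ℚ)).measurable

theorem measurableSet_essBdry [BorelSpace X] (μ : Measure X) (E : Set X) :
    MeasurableSet (essBdry μ E) :=
  (measurableSet_lt measurable_const (measurable_upperDens μ E)).inter
    (measurableSet_lt measurable_const (measurable_upperDens μ Eᶜ))

end UpperDensity

section FinitePerimeter

variable {X : Type*} [MetricSpace X]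

theorem LocLipOn.continuous {f : X → ℝ} (hf : LocLipOn univ f) : Continuous f := by
  refine continuous_iff_continuousAt.2 fun x => ?_
  obtain ⟨K, t, ht, hK⟩ := hf x (mem_univ x)
  rw [nhdsWithin_univ] at ht
  exact hK.continuousOn.continuousAt ht

theorem measurable_lipConst [MeasurableSpace X] [BorelSpace X] {f : X → ℝ}
    (hf : Continuous f) : Measurable (lipConst f) := by
  have h : lipConst f = fun x => ⨅ n : ℕ, ⨆ y : X,
      ⨆ _ : y ∈ ball x (1 / ((n : ℝ) + 1)) ∩ {x}ᶜ,
        ENNReal.ofReal (|f y - f x| / dist y x) := by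
    funext x
    rw [lipConst, (nhdsWithin_hasBasis nhds_basis_ball_inv_nat_succ {x}ᶜ).limsup_eq_iInf_iSup]
    simp
  rw [h]
  refine Measurable.iInf fun n => LowerSemicontinuous.measurable ?_
  refine lowerSemicontinuous_iSup fun y x a ha => ?_
  simp only [lt_iSup_iff] at ha ⊢
  obtain ⟨⟨hy, hyx⟩, ha⟩ := ha
  have hne : y ≠ x := hyx
  have hcont : ContinuousAt (fun z => ENNReal.ofReal (|f y - f z| / dist y z)) x :=
    ENNReal.continuous_ofReal.continuousAt.comp
      (ContinuousAt.div (by fun_prop) (by fun_prop) (dist_ne_zero.2 hne))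
  filter_upwards [hcont.eventually (lt_mem_nhds ha), isOpen_ne.mem_nhds hne.symm,
    ball_mem_nhds x (sub_pos.2 (mem_ball.1 hy))] with z hz hzy hzx
  refine ⟨⟨mem_ball.2 ?_, fun h => hzy (mem_singleton_iff.1 h).symm⟩, hz⟩
  have := dist_triangle_right y z x
  rw [mem_ball] at hzx
  linarith

/-- A binary operation on the reals which is nonexpansive for the `ℓ¹` distance. -/
def Nonexpansive (φ : ℝ → ℝ → ℝ) : Prop :=
  ∀ a b c d, |φ a b - φ c d| ≤ |a - c| + |b - d|

theorem nonexpansive_max : Nonexpansive max := fun a b c d =>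
  (abs_max_sub_max_le_max a b c d).trans (max_le_add_of_nonneg (abs_nonneg _) (abs_nonneg _))

theorem nonexpansive_min : Nonexpansive min := fun a b c d =>
  (abs_min_sub_min_le_max a b c d).trans (max_le_add_of_nonneg (abs_nonneg _) (abs_nonneg _))

variable {φ : ℝ → ℝ → ℝ} {f g : X → ℝ}

theorem Nonexpansive.locLipOn (hφ : Nonexpansive φ) {Ω : Set X} (hf : LocLipOn Ω f)
    (hg : LocLipOn Ω g) : LocLipOn Ω fun x => φ (f x) (g x) := by
  intro x hx
  obtain ⟨K, s, hs, hK⟩ := hf x hx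
  obtain ⟨L, t, ht, hL⟩ := hg x hx
  refine ⟨K + L, s ∩ t, inter_mem hs ht, LipschitzOnWith.of_dist_le_mul fun y hy z hz => ?_⟩
  have h1 := hK.dist_le_mul y hy.1 z hz.1
  have h2 := hL.dist_le_mul y hy.2 z hz.2
  have h3 := hφ (f y) (g y) (f z) (g z)
  rw [Real.dist_eq] at *
  push_cast
  linarith

theorem Nonexpansive.lipConst_le (hφ : Nonexpansive φ) (x : X) :
    lipConst (fun x => φ (f x) (g x)) x ≤ lipConst f x + lipConst g x := by
  refine le_trans (limsup_le_limsup (Eventually.of_forall fun y => ?_))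
    (limsup_add_le_add (𝓝[≠] x) _ _)
  rw [← ENNReal.ofReal_add (by positivity) (by positivity), ← add_div]
  exact ENNReal.ofReal_le_ofReal (div_le_div_of_nonneg_right (hφ _ _ _ _) dist_nonneg)

variable [MeasurableSpace X] {μ : Measure X}

theorem TendstoL1loc.comp {Ω : Set X} {fn : ℕ → X → ℝ} (h : TendstoL1loc μ Ω fn f)
    {k : ℕ → ℕ} (hk : StrictMono k) : TendstoL1loc μ Ω (fun n => fn (k n)) f :=
  fun K hK hKΩ => (h K hK hKΩ).comp hk.tendsto_atTop

theorem exists_approx_of_tvOpen_lt {Ω : Set X} {a : ℝ≥0∞} (h : tvOpen μ f Ω < a) :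
    ∃ fn : ℕ → X → ℝ, (∀ n, LocLipOn Ω (fn n)) ∧ TendstoL1loc μ Ω fn f ∧
      ∀ n, ∫⁻ x in Ω, lipConst (fn n) x ∂μ < a := by
  obtain ⟨_, ⟨fn, hfn, hlim, rfl⟩, hlt⟩ := sInf_lt_iff.1 h
  obtain ⟨k, hk, hka⟩ :=
    extraction_of_frequently_atTop (frequently_lt_of_liminf_lt (by isBoundedDefault) hlt)
  exact ⟨fun n => fn (k n), fun n => hfn _, hlim.comp hk, hka⟩

theorem tv_univ (μ : Measure X) (f : X → ℝ) : tv μ f univ = tvOpen μ f univ := by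
  refine le_antisymm (iInf_le_of_le univ (iInf₂_le isOpen_univ subset_rfl)) ?_
  refine le_iInf fun Ω => le_iInf₂ fun _ hΩ => ?_
  rw [univ_subset_iff.1 hΩ]

theorem Nonexpansive.tendstoL1loc (hφ : Nonexpansive φ) {Ω : Set X} {fn gn : ℕ → X → ℝ}
    (hfn : ∀ n, Measurable (fn n)) (hf : Measurable f) (h : TendstoL1loc μ Ω fn f)
    (h' : TendstoL1loc μ Ω gn g) :
    TendstoL1loc μ Ω (fun n x => φ (fn n x) (gn n x)) (fun x => φ (f x) (g x)) := by
  intro K hK hKΩ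
  refine tendsto_of_tendsto_of_tendsto_of_le_of_le tendsto_const_nhds
    (by simpa using (h K hK hKΩ).add (h' K hK hKΩ)) (fun n => zero_le) fun n => ?_
  simp only
  rw [← lintegral_add_left (by fun_prop)]
  refine lintegral_mono fun x => ?_
  rw [← ENNReal.ofReal_add (abs_nonneg _) (abs_nonneg _)]
  exact ENNReal.ofReal_le_ofReal (hφ _ _ _ _)

variable [BorelSpace X]

theorem Nonexpansive.tvOpen_univ_lt_top (hφ : Nonexpansive φ) (hfm : Measurable f)
    (hf : tvOpen μ f univ < ⊤) (hg : tvOpen μ g univ < ⊤) :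
    tvOpen μ (fun x => φ (f x) (g x)) univ < ⊤ := by
  obtain ⟨a, hfa, ha⟩ := exists_between hf
  obtain ⟨b, hgb, hb⟩ := exists_between hg
  obtain ⟨fn, hfn, hflim, hfint⟩ := exists_approx_of_tvOpen_lt hfa
  obtain ⟨gn, hgn, hglim, hgint⟩ := exists_approx_of_tvOpen_lt hgb
  refine lt_of_le_of_lt (sInf_le ⟨fun n x => φ (fn n x) (gn n x),
    fun n => hφ.locLipOn (hfn n) (hgn n),
    hφ.tendstoL1loc (fun n => (hfn n).continuous.measurable) hfm hflim hglim, rfl⟩) ?_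
  refine lt_of_le_of_lt (liminf_le_of_frequently_le' (x := a + b)
    (Frequently.of_forall fun n => ?_)) (ENNReal.add_lt_top.2 ⟨ha, hb⟩)
  calc ∫⁻ x in univ, lipConst (fun x => φ (fn n x) (gn n x)) x ∂μ
      ≤ ∫⁻ x in univ, (lipConst (fn n) x + lipConst (gn n) x) ∂μ :=
        lintegral_mono fun x => hφ.lipConst_le x
    _ = ∫⁻ x in univ, lipConst (fn n) x ∂μ + ∫⁻ x in univ, lipConst (gn n) x ∂μ :=
        lintegral_add_left (measurable_lipConst (hfn n).continuous) _
    _ ≤ a + b := add_le_add (hfint n).le (hgint n).le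

theorem FinPerim.union {E F : Set X} (hE : FinPerim μ E) (hF : FinPerim μ F) :
    FinPerim μ (E ∪ F) := by
  refine ⟨hE.1.union hF.1, ?_⟩
  have h : (E ∪ F).indicator (fun _ => (1 : ℝ)) =
      fun x => max (E.indicator (fun _ => (1 : ℝ)) x) (F.indicator (fun _ => (1 : ℝ)) x) := by
    funext x
    by_cases hxE : x ∈ E <;> by_cases hxF : x ∈ F <;> simp [hxE, hxF]
  have hE' := hE.2
  have hF' := hF.2
  rw [perim, tv_univ] at hE' hF' ⊢
  rw [h]
  exact nonexpansive_max.tvOpen_univ_lt_top (measurable_const.indicator hE.1) hE' hF'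

theorem FinPerim.inter {E F : Set X} (hE : FinPerim μ E) (hF : FinPerim μ F) :
    FinPerim μ (E ∩ F) := by
  refine ⟨hE.1.inter hF.1, ?_⟩
  have h : (E ∩ F).indicator (fun _ => (1 : ℝ)) =
      fun x => min (E.indicator (fun _ => (1 : ℝ)) x) (F.indicator (fun _ => (1 : ℝ)) x) := by
    funext x
    by_cases hxE : x ∈ E <;> by_cases hxF : x ∈ F <;> simp [hxE, hxF]
  have hE' := hE.2
  have hF' := hF.2
  rw [perim, tv_univ] at hE' hF' ⊢
  rw [h]
  exact nonexpansive_min.tvOpen_univ_lt_top (measurable_const.indicator hE.1) hE' hF'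

end FinitePerimeter

section Isotropic

variable {X : Type*} [MetricSpace X] [MeasurableSpace X] {μ : Measure X}

theorem PerimRepr.perim_univ {θ : Set X → X → ℝ≥0∞} (hθ : PerimRepr μ θ) {E : Set X}
    (hE : FinPerim μ E) : perim μ E univ = outerLint (codimH μ) (essBdry μ E) (θ E) := by
  obtain ⟨_, _, _, _, h⟩ := hθ
  rw [(h E hE).2 univ MeasurableSet.univ, univ_inter]

theorem Isotropic.codimH_empty (hIso : Isotropic μ) {E : Set X} (hE : FinPerim μ E) :
    codimH μ ∅ = 0 := by
  obtain ⟨θ, -, hiso⟩ := hIso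
  simpa using hiso E E hE hE subset_rfl

variable [BorelSpace X]

/-- In an isotropic space, the defect of additivity of the perimeter for disjoint sets is
carried by the common part of the essential boundaries. -/
theorem perim_union_eq_add_iff (hIso : Isotropic μ) {E F : Set X} (hE : FinPerim μ E)
    (hF : FinPerim μ F) (hEF : Disjoint E F) :
    perim μ (E ∪ F) univ = perim μ E univ + perim μ F univ ↔
      codimH μ (essBdry μ E ∩ essBdry μ F) = 0 := by
  have h₀ := hIso.codimH_empty hE
  obtain ⟨θ, hθ, hiso⟩ := hIso
  have hG := hE.union hF
  set ν := codimOuterMeasure μ h₀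
  have hν : ∀ S, codimH μ S = ν S := fun S => rfl
  have hcar : ∀ D : Set X, ν.IsCaratheodory (essBdry μ D) := fun D =>
    codimOuterMeasure_isCaratheodory h₀ (measurableSet_essBdry μ D)
  have hdiff : essBdry μ (E ∪ F) \ essBdry μ E = essBdry μ F \ essBdry μ E := by
    ext x
    refine ⟨fun hx => ⟨(essBdry_union_subset E F hx.1).resolve_left hx.2, hx.2⟩,
      fun hx => ⟨?_, hx.2⟩⟩
    by_contra hxG
    rw [union_comm] at hxG
    exact hx.2 (essBdry_diff_essBdry_union_subset hEF.symm ⟨hx.1, hxG⟩).2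
  have hrep : ∀ {D : Set X}, FinPerim μ D →
      perim μ D univ = outerLint ν (essBdry μ D) (θ D) := fun hD => hθ.perim_univ hD
  have hcongrE : outerLint ν (essBdry μ (E ∪ F) ∩ essBdry μ E) (θ (E ∪ F)) =
      outerLint ν (essBdry μ E ∩ essBdry μ (E ∪ F)) (θ E) := by
    rw [inter_comm]
    refine outerLint_congr_of_null ν ?_
    rw [← hν]
    simpa only [ne_comm] using hiso (E ∪ F) E hG hE subset_union_left
  have hcongrF : outerLint ν (essBdry μ F \ essBdry μ E) (θ (E ∪ F)) =
      outerLint ν (essBdry μ F \ essBdry μ E) (θ F) := by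
    refine outerLint_congr_of_null ν (measure_mono_null (fun x hx => ?_)
      (hiso (E ∪ F) F hG hF subset_union_right))
    exact ⟨⟨hx.1.1, (hdiff ▸ hx.1 : x ∈ essBdry μ (E ∪ F) \ essBdry μ E).1⟩, hx.2.symm⟩
  have hsum : perim μ E univ + perim μ F univ = perim μ (E ∪ F) univ +
      (outerLint ν (essBdry μ E \ essBdry μ (E ∪ F)) (θ E) +
        outerLint ν (essBdry μ F ∩ essBdry μ E) (θ F)) := by
    rw [hrep hE, hrep hF, hrep hG,
      ← outerLint_inter_add_diff ν (hcar (E ∪ F)) (essBdry μ E),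
      ← outerLint_inter_add_diff ν (hcar E) (essBdry μ F),
      ← outerLint_inter_add_diff ν (hcar E) (essBdry μ (E ∪ F)), hdiff, hcongrE, hcongrF]
    ring
  rw [hsum, hν]
  constructor
  · intro h
    have hzero := (ENNReal.add_right_inj hG.2.ne).1 ((add_zero _).trans h)
    obtain ⟨γ, C, hγ, -, hrepr⟩ := hθ
    rw [inter_comm]
    exact null_of_outerLint_eq_zero ν hγ (fun x hx => ((hrepr F hF).1 x hx.1).1)
      (add_eq_zero.1 hzero.symm).2
  · intro h
    rw [outerLint_of_null ν (measure_mono_null (essBdry_diff_essBdry_union_subset hEF) h),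
      outerLint_of_null ν (by rwa [inter_comm]), add_zero, add_zero]

/-- An indecomposable set is essentially contained in one of two disjoint pieces covering it,
as soon as the essential boundaries of the pieces have negligible intersection. -/
theorem Indecomposable.measure_inter_eq_zero_or (hIso : Isotropic μ) {E G G' : Set X}
    (hE : Indecomposable μ E) (hG : FinPerim μ G) (hG' : FinPerim μ G') (hd : Disjoint G G')
    (hcov : E ⊆ G ∪ G') (hnull : codimH μ (essBdry μ G ∩ essBdry μ G') = 0) :
    μ (E ∩ G) = 0 ∨ μ (E ∩ G') = 0 := by
  by_contra! hne
  have hunion : E ∩ G ∪ E ∩ G' = E := by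
    rw [← inter_union_distrib_left, inter_eq_left.2 hcov]
  have hdisj : Disjoint (E ∩ G) (E ∩ G') := hd.mono inter_subset_right inter_subset_right
  have hEG := hE.1.inter hG
  have hEG' := hE.1.inter hG'
  have h₀ := hIso.codimH_empty hE.1
  have hsub : essBdry μ (E ∩ G) ∩ essBdry μ (E ∩ G') ⊆ essBdry μ G ∩ essBdry μ G' :=
    fun x hx => mem_essBdry_inter_of_disjoint hd
      (hx.1.1.trans_le (upperDens_mono inter_subset_right x))
      (hx.2.1.trans_le (upperDens_mono inter_subset_right x))
  have hperim := (perim_union_eq_add_iff hIso hEG hEG' hdisj).2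
    (measure_mono_null (μ := codimOuterMeasure μ h₀) hsub hnull)
  refine hE.2 ⟨E ∩ G, E ∩ G', hEG, hEG', hdisj, by rw [hunion, inter_univ],
    pos_iff_ne_zero.2 hne.1, pos_iff_ne_zero.2 hne.2, ?_⟩
  rwa [hunion] at hperim

end Isotropic

variable {X : Type*} [MetricSpace X] [CompleteSpace X] [TopologicalSpace.SeparableSpace X]
  [MeasurableSpace X] [BorelSpace X]

/-- Stability of indecomposable sets, II. -/
theorem indecomposable_union
    (μ : Measure X) [IsLocallyFiniteMeasure μ] (hμ : μ ≠ 0)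
    (hPI : IsPI μ) (hIso : Isotropic μ)
    (E F : Set X) (hE : Indecomposable μ E) (hF : Indecomposable μ F)
    (h : 0 < μ (E ∩ F) ∨ 0 < codimH μ (essBdry μ E ∩ essBdry μ F)) :
    Indecomposable μ (E ∪ F) := by
  refine ⟨hE.1.union hF.1, ?_⟩
  rintro ⟨G, G', hG, hG', hd, hcov, hGpos, hGpos', hperim⟩
  rw [inter_univ] at hcov
  rw [← hcov, perim_union_eq_add_iff hIso hG hG' hd] at hperim
  have hEcov : E ⊆ G ∪ G' := hcov ▸ subset_union_left
  have hFcov : F ⊆ G ∪ G' := hcov ▸ subset_union_right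
  have hGcov : G ⊆ E ∩ G ∪ F ∩ G := fun x hx =>
    (hcov ▸ Or.inl hx : x ∈ E ∪ F).imp (fun h => ⟨h, hx⟩) (fun h => ⟨h, hx⟩)
  have hGcov' : G' ⊆ E ∩ G' ∪ F ∩ G' := fun x hx =>
    (hcov ▸ Or.inr hx : x ∈ E ∪ F).imp (fun h => ⟨h, hx⟩) (fun h => ⟨h, hx⟩)
  have separated : ∀ {D D' : Set X}, Disjoint D D' → E ⊆ D ∪ D' → F ⊆ D ∪ D' →
      codimH μ (essBdry μ D ∩ essBdry μ D') = 0 → μ (E ∩ D') = 0 → μ (F ∩ D) = 0 → False := by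
    intro D D' hDD hED hFD hnull hE0 hF0
    have hle : ∀ {A B B' : Set X}, A ⊆ B ∪ B' → μ (A ∩ B') = 0 → A ≤ᵐ[μ] B :=
      fun {A B B'} hA h0 => ae_le_set.2 (measure_mono_null (t := A ∩ B')
        (fun x hx => ⟨hx.1, (hA hx.1).resolve_left hx.2⟩) h0)
    have hEle : E ≤ᵐ[μ] D := hle hED hE0
    have hFle : F ≤ᵐ[μ] D' := hle (union_comm D D' ▸ hFD) hF0
    have h₀ := hIso.codimH_empty hE.1
    rcases h with h | h
    · refine h.ne' (measure_mono_null (t := E ∩ D' ∪ F ∩ D) (fun x hx => ?_)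
        (measure_union_null hE0 hF0))
      exact (hED hx.1).symm.imp (And.intro hx.1) (And.intro hx.2)
    · refine h.ne' (measure_mono_null (μ := codimOuterMeasure μ h₀) (fun x hx => ?_) hnull)
      exact mem_essBdry_inter_of_disjoint hDD (hx.1.1.trans_le (upperDens_mono_ae hEle x))
        (hx.2.1.trans_le (upperDens_mono_ae hFle x))
  rcases hE.measure_inter_eq_zero_or hIso hG hG' hd hEcov hperim with hE0 | hE0 <;>
    rcases hF.measure_inter_eq_zero_or hIso hG hG' hd hFcov hperim with hF0 | hF0
  · exact hGpos.ne' (measure_mono_null hGcov (measure_union_null hE0 hF0))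
  · exact separated hd.symm (union_comm G G' ▸ hEcov) (union_comm G G' ▸ hFcov)
      (inter_comm (essBdry μ G) _ ▸ hperim) hE0 hF0
  · exact separated hd hEcov hFcov hperim hE0 hF0
  · exact hGpos'.ne' (measure_mono_null hGcov' (measure_union_null hE0 hF0))

end PaperBV
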